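/- arXiv:1805.10791 — 2 statements merged into one kernel-verified Lean document; each statement's English description precedes it below -/
import Mathlib

section
/- Let d, s be integers with 1 ≤ s ≤ d and s² ≤ 4d, let ε > 0 and γ > 1. Let N̂*_γ = Σ_{i=1}^d (|y_i|^γ − ε^γ α_γ) · 1_{y_i² > 2ε² log(1+d/s²)}, where α_γ = E(|ξ|^γ 1_{ξ² > 2 log(1+d/s²)}) / P(ξ² > 2 log(1+d/s²)) for ξ ~ N(0,1), and set n̂*_γ = |N̂*_γ|^{1/γ}. Then there exists a constant C > 0 depending only on γ such that sup over θ ∈ B_0(s) of E_θ[(n̂*_γ − ‖θ‖_γ)²] is at most C ε² s^{2/γ} log(1+d/s²). -/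
open MeasureTheory ProbabilityTheory Real

/-- Gaussian tail bound, obtained from the sub-Gaussian Chernoff bound. -/
lemma gaussianReal_real_lt_sq_le {u : ℝ} (hu : 0 ≤ u) :
    (gaussianReal 0 1).real {x : ℝ | u < x ^ 2} ≤ 2 * exp (-u / 2) := by
  have hsub : HasSubgaussianMGF id 1 (gaussianReal 0 1) :=
    ⟨fun t => by simpa using integrable_exp_mul_gaussianReal t,
      fun t => by simp [mgf_id_gaussianReal]⟩
  have h1 := hsub.measure_ge_le (sqrt_nonneg u)
  have h2 := hsub.neg.measure_ge_le (sqrt_nonneg u)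
  simp only [sq_sqrt hu, NNReal.coe_one, mul_one, id, Pi.neg_apply] at h1 h2
  have hcover : {x : ℝ | u < x ^ 2} ⊆ {x | √u ≤ x} ∪ {x | √u ≤ -x} := fun x hx => by
    have : √u < |x| := by
      rw [← sqrt_sq_eq_abs]
      exact sqrt_lt_sqrt hu hx
    rcases le_total 0 x with h | h
    · exact Or.inl (by rw [abs_of_nonneg h] at this; exact this.le)
    · exact Or.inr (by rw [abs_of_nonpos h] at this; exact this.le)
  calc _ ≤ _ := measureReal_mono hcover
    _ ≤ _ := measureReal_union_le _ _
    _ ≤ _ := by linarith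

/-- A crude lower bound for Gaussian tails, exponentially loose but free of side conditions. -/
lemma exp_neg_le_gaussianReal_real_lt_sq {u : ℝ} (hu : 0 ≤ u) :
    (√(2 * π))⁻¹ * exp (-1) * exp (-u) ≤ (gaussianReal 0 1).real {x : ℝ | u < x ^ 2} := by
  have hsub : Set.Ioc √u (√u + 1) ⊆ {x : ℝ | u < x ^ 2} := fun x hx =>
    (lt_sq_of_sqrt_lt hx.1)
  refine le_trans ?_ (measureReal_mono hsub)
  rw [measureReal_def, gaussianReal_apply_eq_integral _ one_ne_zero, ENNReal.toReal_ofReal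
    (setIntegral_nonneg measurableSet_Ioc fun x _ => gaussianPDFReal_nonneg _ _ _)]
  have hconst : ∫ _ in Set.Ioc √u (√u + 1), (√(2 * π))⁻¹ * exp (-1) * exp (-u) =
      (√(2 * π))⁻¹ * exp (-1) * exp (-u) := by simp
  rw [← hconst]
  refine setIntegral_mono_on (integrable_const _)
    (integrable_gaussianPDFReal 0 1).integrableOn measurableSet_Ioc fun x hx => ?_
  rw [gaussianPDFReal, mul_assoc, ← exp_add]
  simp only [NNReal.coe_one, mul_one, sub_zero]
  gcongr
  have h0 : 0 ≤ x := (sqrt_nonneg u).trans hx.1.le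
  nlinarith [sq_sqrt hu, sq_nonneg (√u - 1), hx.2, sqrt_nonneg u]

lemma abs_rpow_sq (x p : ℝ) : (|x| ^ p) ^ 2 = |x| ^ (2 * p) := by
  rw [mul_comm, rpow_mul (abs_nonneg x), rpow_two]

lemma integrable_abs_rpow_gaussianReal {p : ℝ} (hp : 0 ≤ p) :
    Integrable (fun x : ℝ => |x| ^ p) (gaussianReal 0 1) := by
  have h := (memLp_id_gaussianReal (μ := 0) (v := 1) p.toNNReal).integrable_norm_rpow'
  simpa [hp] using h

lemma measurableSet_lt_sq (u : ℝ) : MeasurableSet {x : ℝ | u < x ^ 2} :=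
  measurableSet_lt measurable_const (by fun_prop)

/-- Conditionally on `u < ξ²`, the `p`-th absolute moment of a standard Gaussian variable `ξ` is of
order `u ^ (p / 2)`, uniformly over `u` bounded away from `0`. -/
lemma exists_setIntegral_abs_rpow_le {p u₀ : ℝ} (hp : 0 < p) (hu₀ : 0 < u₀) :
    ∃ K : ℝ, 0 < K ∧ ∀ u, u₀ ≤ u →
      ∫ x in {x : ℝ | u < x ^ 2}, |x| ^ p ∂(gaussianReal 0 1) ≤
        K * u ^ (p / 2) * (gaussianReal 0 1).real {x : ℝ | u < x ^ 2} := by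
  set m : ℝ := ∫ x, |x| ^ (2 * p) ∂(gaussianReal 0 1)
  have hm : 0 ≤ m := integral_nonneg fun x => by positivity
  set c : ℝ := (√(2 * π))⁻¹ * exp (-1)
  have hc : 0 < c := by positivity
  refine ⟨4 ^ (p / 2) + (m + 2) / 2 / c / u₀ ^ (p / 2), by positivity, fun u hu => ?_⟩
  have hu' : 0 < u := hu₀.trans_le hu
  set P := (gaussianReal 0 1).real {x : ℝ | u < x ^ 2}
  set B : Set ℝ := {x : ℝ | 4 * u < x ^ 2}
  have hB : MeasurableSet B := measurableSet_lt_sq _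
  have hpt : ∀ x : ℝ, |x| ^ p ≤ (4 * u) ^ (p / 2) +
      (exp (-u) * |x| ^ (2 * p) + exp u * B.indicator 1 x) / 2 := fun x => by
    by_cases hx : x ∈ B
    · have he : exp (-u) * exp u = 1 := by rw [← exp_add]; simp
      rw [Set.indicator_of_mem hx, ← abs_rpow_sq, Pi.one_apply]
      have h4 : 0 ≤ (4 * u) ^ (p / 2) := by positivity
      have h5 : 0 ≤ exp u * (exp (-u) * |x| ^ p - 1) ^ 2 := by positivity
      have h6 : exp u * (exp (-u) * |x| ^ p - 1) ^ 2 =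
          exp (-u) * (|x| ^ p) ^ 2 + exp u * 1 - 2 * |x| ^ p := by
        linear_combination (exp (-u) * (|x| ^ p) ^ 2 - 2 * |x| ^ p) * he
      linarith
    · have hx' : x ^ 2 ≤ 4 * u := not_lt.1 hx
      have : |x| ^ p = (x ^ 2) ^ (p / 2) := by
        rw [← sq_abs, ← rpow_two, ← rpow_mul (abs_nonneg x)]
        congr 1; ring
      rw [Set.indicator_of_notMem hx, this]
      have h1 : (x ^ 2) ^ (p / 2) ≤ (4 * u) ^ (p / 2) := by gcongr
      have h2 : 0 ≤ exp (-u) * |x| ^ (2 * p) := by positivity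
      linarith
  have hi1 := (integrable_abs_rpow_gaussianReal (p := 2 * p) (by positivity)).const_mul (exp (-u))
  have hi2 : Integrable (fun x => exp u * B.indicator (1 : ℝ → ℝ) x) (gaussianReal 0 1) :=
    ((integrable_const (1 : ℝ)).indicator hB).const_mul _
  have hi3 : Integrable (fun x =>
      (exp (-u) * |x| ^ (2 * p) + exp u * B.indicator (1 : ℝ → ℝ) x) / 2) (gaussianReal 0 1) :=
    (hi1.add hi2).div_const 2
  have hBI : ∫ x, B.indicator (1 : ℝ → ℝ) x ∂(gaussianReal 0 1) ≤ 2 * exp (-(2 * u)) := by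
    rw [integral_indicator_one hB]
    refine (gaussianReal_real_lt_sq_le (by positivity)).trans_eq ?_
    congr 2; ring
  have hexp : exp (-u) ≤ P / c := by
    rw [le_div_iff₀ hc, mul_comm]
    exact exp_neg_le_gaussianReal_real_lt_sq hu'.le
  calc ∫ x in {x : ℝ | u < x ^ 2}, |x| ^ p ∂(gaussianReal 0 1)
      ≤ ∫ x in {x : ℝ | u < x ^ 2}, ((4 * u) ^ (p / 2) +
          (exp (-u) * |x| ^ (2 * p) + exp u * B.indicator 1 x) / 2) ∂(gaussianReal 0 1) :=
        setIntegral_mono (integrable_abs_rpow_gaussianReal hp.le).integrableOn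
          ((integrable_const _).add hi3).integrableOn hpt
    _ = (4 * u) ^ (p / 2) * P + ∫ x in {x : ℝ | u < x ^ 2},
          (exp (-u) * |x| ^ (2 * p) + exp u * B.indicator 1 x) / 2 ∂(gaussianReal 0 1) := by
        rw [integral_add (integrable_const _) hi3.integrableOn]
        simp [P, mul_comm]
    _ ≤ (4 * u) ^ (p / 2) * P + ∫ x,
          (exp (-u) * |x| ^ (2 * p) + exp u * B.indicator 1 x) / 2 ∂(gaussianReal 0 1) := by
        refine add_le_add_right (setIntegral_le_integral hi3 (Filter.Eventually.of_forall fun x => ?_)) _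
        have : 0 ≤ B.indicator (1 : ℝ → ℝ) x := Set.indicator_nonneg (fun _ _ => zero_le_one) x
        simp only [Pi.zero_apply]
        positivity
    _ = (4 * u) ^ (p / 2) * P + (exp (-u) * m +
          exp u * ∫ x, B.indicator 1 x ∂(gaussianReal 0 1)) / 2 := by
        rw [integral_div, integral_add hi1 hi2, integral_const_mul, integral_const_mul]
    _ ≤ (4 * u) ^ (p / 2) * P + (exp (-u) * m + exp u * (2 * exp (-(2 * u)))) / 2 := by gcongr
    _ = (4 * u) ^ (p / 2) * P + (m + 2) / 2 * exp (-u) := by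
        have : exp u * exp (-(2 * u)) = exp (-u) := by rw [← exp_add]; congr 1; ring
        linear_combination this
    _ ≤ (4 * u) ^ (p / 2) * P + (m + 2) / 2 * (P / c) := by gcongr
    _ ≤ (4 * u) ^ (p / 2) * P + (m + 2) / 2 * (P / c) * (u ^ (p / 2) / u₀ ^ (p / 2)) := by
        have h1 : 1 ≤ u ^ (p / 2) / u₀ ^ (p / 2) := by
          rw [one_le_div (by positivity)]; gcongr
        have hP : 0 ≤ P := measureReal_nonneg
        exact add_le_add_right (le_mul_of_one_le_right (by positivity) h1) _
    _ = _ := by rw [mul_rpow (by norm_num) hu'.le]; ring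

lemma abs_rpow_sub_rpow_le {a b q : ℝ} (ha : 0 ≤ a) (hb : 0 ≤ b) (hq : 0 ≤ q) (hq1 : q ≤ 1) :
    |a ^ q - b ^ q| ≤ |a - b| ^ q := by
  wlog hab : b ≤ a generalizing a b
  · rw [abs_sub_comm, abs_sub_comm a]
    exact this hb ha (le_of_not_ge hab)
  have h := rpow_add_le_add_rpow hb (sub_nonneg.2 hab) hq hq1
  rw [add_sub_cancel] at h
  rw [abs_of_nonneg (sub_nonneg.2 hab), abs_of_nonneg (sub_nonneg.2 (by gcongr))]
  linarith

lemma rpow_le_rpow_mul_one_add_sq {z c p : ℝ} (hz : 0 ≤ z) (hc : 0 < c) (hp : 0 ≤ p)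
    (hp2 : p ≤ 2) : z ^ p ≤ c ^ p * (1 + (z / c) ^ 2) := by
  have hz' : z = c * (z / c) := by field_simp
  have h0 : 0 ≤ z / c := by positivity
  conv_lhs => rw [hz', mul_rpow hc.le h0]
  gcongr
  rcases le_total (z / c) 1 with h | h
  · exact (rpow_le_one h0 h hp).trans (by nlinarith)
  · have := rpow_le_rpow_of_exponent_le h hp2
    rw [rpow_two] at this
    linarith

/-- Deterministic error bound for the thresholding estimator of `‖θ‖_γ`, for `θ` supported
in `S`. -/
lemma abs_threshold_norm_sub_norm_le {ι : Type*} [Fintype ι] [DecidableEq ι] {γ A T : ℝ}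
    (hγ : 1 ≤ γ) (hA : 0 ≤ A) (hT : 0 ≤ T) (S : Finset ι) (θ y : ι → ℝ)
    (hθ : ∀ i ∉ S, θ i = 0) :
    |(|∑ i, (|y i| ^ γ - A) * (if T < y i ^ 2 then (1 : ℝ) else 0)| ^ (1 / γ)
        - (∑ i, |θ i| ^ γ) ^ (1 / γ))| ≤
      (S.card * (T ^ (γ / 2) + A) +
        |∑ i ∈ Sᶜ, (|y i| ^ γ - A) * (if T < y i ^ 2 then (1 : ℝ) else 0)|) ^ (1 / γ) +
      (∑ i ∈ S, |y i - θ i| ^ γ) ^ (1 / γ) := by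
  have hγ0 : 0 < γ := by linarith
  have hq0 : 0 ≤ 1 / γ := by positivity
  have hq1 : 1 / γ ≤ 1 := (div_le_one hγ0).2 hγ
  set w : ι → ℝ := fun i => (|y i| ^ γ - A) * (if T < y i ^ 2 then (1 : ℝ) else 0)
  set Y : ℝ := ∑ i ∈ S, |y i| ^ γ
  have hY : 0 ≤ Y := Finset.sum_nonneg fun i _ => by positivity
  have hθS : ∑ i, |θ i| ^ γ = ∑ i ∈ S, |θ i| ^ γ :=
    (Finset.sum_subset (Finset.subset_univ S) fun i _ hi => by simp [hθ i hi, hγ0.ne']).symm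
  have hw : ∀ i, |w i - |y i| ^ γ| ≤ T ^ (γ / 2) + A := fun i => by
    have hT' : 0 ≤ T ^ (γ / 2) := by positivity
    by_cases h : T < y i ^ 2
    · have : w i - |y i| ^ γ = -A := by simp only [w, if_pos h]; ring
      rw [this, abs_neg, abs_of_nonneg hA]
      linarith
    · have : w i - |y i| ^ γ = -|y i| ^ γ := by simp only [w, if_neg h]; ring
      have hyi : |y i| ^ γ = (y i ^ 2) ^ (γ / 2) := by
        rw [← sq_abs, ← rpow_two, ← rpow_mul (abs_nonneg _)]
        congr 1; ring
      rw [this, abs_neg, abs_of_nonneg (by positivity), hyi]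
      have : (y i ^ 2) ^ (γ / 2) ≤ T ^ (γ / 2) := by gcongr; exact not_lt.1 h
      linarith
  have hN : |(|∑ i, w i| - Y)| ≤ S.card * (T ^ (γ / 2) + A) + |∑ i ∈ Sᶜ, w i| := by
    calc |(|∑ i, w i| - Y)| = |(|∑ i, w i| - |Y|)| := by rw [abs_of_nonneg hY]
      _ ≤ |(∑ i, w i) - Y| := abs_abs_sub_abs_le_abs_sub _ _
      _ = |∑ i ∈ S, (w i - |y i| ^ γ) + ∑ i ∈ Sᶜ, w i| := by
          rw [← Finset.sum_add_sum_compl S w, Finset.sum_sub_distrib]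
          congr 1; ring
      _ ≤ |∑ i ∈ S, (w i - |y i| ^ γ)| + |∑ i ∈ Sᶜ, w i| := abs_add_le _ _
      _ ≤ _ := by
          gcongr
          refine (Finset.abs_sum_le_sum_abs _ _).trans ?_
          simpa only [nsmul_eq_mul] using Finset.sum_le_card_nsmul S _ _ fun i _ => hw i
  have h1 : |(|∑ i, w i| ^ (1 / γ) - Y ^ (1 / γ))| ≤
      (S.card * (T ^ (γ / 2) + A) + |∑ i ∈ Sᶜ, w i|) ^ (1 / γ) :=
    (abs_rpow_sub_rpow_le (abs_nonneg _) hY hq0 hq1).trans (by gcongr)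
  have h2 : |(Y ^ (1 / γ) - (∑ i ∈ S, |θ i| ^ γ) ^ (1 / γ))| ≤
      (∑ i ∈ S, |y i - θ i| ^ γ) ^ (1 / γ) := by
    have e1 := Real.Lp_add_le S θ (fun i => y i - θ i) hγ
    have e2 := Real.Lp_add_le S y (fun i => θ i - y i) hγ
    simp only [add_sub_cancel, abs_sub_comm (θ _) (y _)] at e1 e2
    exact abs_sub_le_iff.2 ⟨by linarith, by linarith⟩
  rw [hθS]
  exact (abs_sub_le _ _ _).trans (add_le_add h1 h2)

section ProductMeasure

variable {ι : Type*} [Fintype ι] {μ : Measure ℝ} [IsProbabilityMeasure μ] {f : ℝ → ℝ}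

lemma memLp_two_sum_comp_eval (hf : MemLp f 2 μ) (J : Finset ι) :
    MemLp (fun x : ι → ℝ => ∑ i ∈ J, f (x i)) 2 (Measure.pi fun _ => μ) :=
  memLp_finsetSum J fun i _ =>
    hf.comp_measurePreserving (measurePreserving_eval (fun _ => μ) i)

lemma integral_sq_sum_comp_eval_le (hf : MemLp f 2 μ) (J : Finset ι) :
    ∫ x : ι → ℝ, (∑ i ∈ J, f (x i)) ^ 2 ∂(Measure.pi fun _ => μ) ≤
      (J.card : ℝ) ^ 2 * ∫ x, f x ^ 2 ∂μ := by
  have hi : ∀ i : ι, Integrable (fun x : ι → ℝ => f (x i) ^ 2) (Measure.pi fun _ => μ) :=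
    fun i => (hf.comp_measurePreserving (measurePreserving_eval (fun _ => μ) i)).integrable_sq
  calc ∫ x : ι → ℝ, (∑ i ∈ J, f (x i)) ^ 2 ∂(Measure.pi fun _ => μ)
      ≤ ∫ x : ι → ℝ, (J.card : ℝ) * ∑ i ∈ J, f (x i) ^ 2 ∂(Measure.pi fun _ => μ) :=
        integral_mono (memLp_two_sum_comp_eval hf J).integrable_sq
          ((integrable_finsetSum J fun i _ => hi i).const_mul _)
          fun x => sq_sum_le_card_mul_sum_sq
    _ = (J.card : ℝ) * ∑ i ∈ J, ∫ x : ι → ℝ, f (x i) ^ 2 ∂(Measure.pi fun _ => μ) := by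
        rw [integral_const_mul, integral_finsetSum J fun i _ => hi i]
    _ = (J.card : ℝ) * ∑ i ∈ J, ∫ x, f x ^ 2 ∂μ := by
        congr 1
        refine Finset.sum_congr rfl fun i _ => ?_
        exact integral_comp_eval (μ := fun _ : ι => μ) (f := fun x => f x ^ 2)
          hf.integrable_sq.aestronglyMeasurable
    _ = _ := by rw [Finset.sum_const, nsmul_eq_mul]; ring

lemma integral_sq_sum_comp_eval_of_integral_eq_zero (hf : MemLp f 2 μ) (h0 : ∫ x, f x ∂μ = 0)
    (J : Finset ι) :
    ∫ x : ι → ℝ, (∑ i ∈ J, f (x i)) ^ 2 ∂(Measure.pi fun _ => μ) =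
      J.card * ∫ x, f x ^ 2 ∂μ := by
  have hm : ∀ i : ι, MemLp (fun x : ι → ℝ => f (x i)) 2 (Measure.pi fun _ => μ) := fun i =>
    hf.comp_measurePreserving (measurePreserving_eval (fun _ => μ) i)
  have hz : ∀ i : ι, ∫ x : ι → ℝ, f (x i) ∂(Measure.pi fun _ => μ) = 0 := fun i =>
    (integral_comp_eval (μ := fun _ : ι => μ) hf.aestronglyMeasurable).trans h0
  have hind : iIndepFun (fun (i : ι) (x : ι → ℝ) => f (x i)) (Measure.pi fun _ => μ) :=
    iIndepFun_pi (X := fun _ => f) fun _ => hf.aestronglyMeasurable.aemeasurable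
  have hvar := IndepFun.variance_sum (s := J) (fun i _ => hm i)
    fun i _ j _ hij => hind.indepFun hij
  have hsum : (∑ i ∈ J, fun x : ι → ℝ => f (x i)) = fun x => ∑ i ∈ J, f (x i) := by
    ext x; simp
  rw [hsum, variance_of_integral_eq_zero
    (memLp_two_sum_comp_eval hf J).aestronglyMeasurable.aemeasurable
    (by rw [integral_finsetSum J fun i _ => (hm i).integrable one_le_two]; simp [hz])] at hvar
  rw [hvar, ← nsmul_eq_mul, ← Finset.sum_const]
  refine Finset.sum_congr rfl fun i _ => ?_
  rw [variance_of_integral_eq_zero (hm i).aestronglyMeasurable.aemeasurable (hz i)]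
  exact integral_comp_eval (μ := fun _ : ι => μ) (f := fun x => f x ^ 2)
    hf.integrable_sq.aestronglyMeasurable

end ProductMeasure

lemma memLp_two_abs_rpow_gaussianReal {p : ℝ} (hp : 0 ≤ p) :
    MemLp (fun x : ℝ => |x| ^ p) 2 (gaussianReal 0 1) := by
  refine (memLp_two_iff_integrable_sq
    (integrable_abs_rpow_gaussianReal hp).aestronglyMeasurable).2 ?_
  simpa only [abs_rpow_sq] using integrable_abs_rpow_gaussianReal (p := 2 * p) (by positivity)

/-- The truncated conditional moment `E(|ξ|^γ 1_{u < ξ²}) / P(u < ξ²)` of a standard Gaussian. -/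
noncomputable def truncatedMoment (γ u : ℝ) : ℝ :=
  (∫ x in {x : ℝ | u < x ^ 2}, |x| ^ γ ∂(gaussianReal 0 1)) /
    (gaussianReal 0 1).real {x : ℝ | u < x ^ 2}

/-- The contribution of a single pure-noise coordinate to the thresholding estimator. -/
noncomputable def noiseTerm (γ u x : ℝ) : ℝ :=
  (|x| ^ γ - truncatedMoment γ u) * (if u < x ^ 2 then (1 : ℝ) else 0)

lemma truncatedMoment_nonneg (γ u : ℝ) : 0 ≤ truncatedMoment γ u :=
  div_nonneg (integral_nonneg fun x => by positivity) measureReal_nonneg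

lemma noiseTerm_eq_indicator (γ u : ℝ) :
    noiseTerm γ u = {x : ℝ | u < x ^ 2}.indicator fun x => |x| ^ γ - truncatedMoment γ u := by
  ext x
  simp [noiseTerm, Set.indicator_apply]

lemma gaussianReal_real_lt_sq_pos {u : ℝ} (hu : 0 ≤ u) :
    0 < (gaussianReal 0 1).real {x : ℝ | u < x ^ 2} :=
  lt_of_lt_of_le (by positivity) (exp_neg_le_gaussianReal_real_lt_sq hu)

lemma memLp_noiseTerm {γ : ℝ} (hγ : 0 ≤ γ) (u : ℝ) :
    MemLp (noiseTerm γ u) 2 (gaussianReal 0 1) := by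
  rw [noiseTerm_eq_indicator]
  exact ((memLp_two_abs_rpow_gaussianReal hγ).sub (memLp_const _)).indicator
    (measurableSet_lt_sq u)

lemma integral_noiseTerm {γ u : ℝ} (hγ : 0 ≤ γ) (hu : 0 ≤ u) :
    ∫ x, noiseTerm γ u x ∂(gaussianReal 0 1) = 0 := by
  rw [noiseTerm_eq_indicator, integral_indicator (measurableSet_lt_sq u),
    integral_sub (integrable_abs_rpow_gaussianReal hγ).integrableOn (integrable_const _)]
  have := (gaussianReal_real_lt_sq_pos hu).ne'
  simp [truncatedMoment, mul_div_cancel₀, this]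

lemma exists_truncatedMoment_le {γ u₀ : ℝ} (hγ : 0 < γ) (hu₀ : 0 < u₀) :
    ∃ K : ℝ, 0 < K ∧ ∀ u, u₀ ≤ u → truncatedMoment γ u ≤ K * u ^ (γ / 2) := by
  obtain ⟨K, hK, h⟩ := exists_setIntegral_abs_rpow_le hγ hu₀
  refine ⟨K, hK, fun u hu => ?_⟩
  rw [truncatedMoment, div_le_iff₀ (gaussianReal_real_lt_sq_pos (hu₀.le.trans hu))]
  exact h u hu

lemma exists_integral_noiseTerm_sq_le {γ u₀ : ℝ} (hγ : 0 < γ) (hu₀ : 0 < u₀) :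
    ∃ K : ℝ, 0 < K ∧ ∀ u, u₀ ≤ u →
      ∫ x, noiseTerm γ u x ^ 2 ∂(gaussianReal 0 1) ≤ K * u ^ γ * exp (-u / 2) := by
  obtain ⟨K₁, hK₁, h₁⟩ := exists_truncatedMoment_le hγ hu₀
  obtain ⟨K₂, hK₂, h₂⟩ := exists_setIntegral_abs_rpow_le (mul_pos two_pos hγ) hu₀
  refine ⟨2 * (K₂ + K₁ ^ 2), by positivity, fun u hu => ?_⟩
  have hu' : 0 < u := hu₀.trans_le hu
  set a := truncatedMoment γ u
  have ha : 0 ≤ a := truncatedMoment_nonneg γ u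
  have hi : Integrable (fun x : ℝ => |x| ^ (2 * γ)) (gaussianReal 0 1) :=
    integrable_abs_rpow_gaussianReal (by positivity)
  set P := (gaussianReal 0 1).real {x : ℝ | u < x ^ 2}
  have hpow : (u ^ (γ / 2)) ^ 2 = u ^ γ := by
    rw [← rpow_two, ← rpow_mul hu'.le]; congr 1; ring
  have hsq : ∀ x, noiseTerm γ u x ^ 2 ≤
      {x : ℝ | u < x ^ 2}.indicator (fun x => |x| ^ (2 * γ) + a ^ 2) x := fun x => by
    rw [noiseTerm_eq_indicator]
    by_cases hx : x ∈ {x : ℝ | u < x ^ 2}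
    · rw [Set.indicator_of_mem hx, Set.indicator_of_mem hx, ← abs_rpow_sq]
      nlinarith [mul_nonneg (rpow_nonneg (abs_nonneg x) γ) ha]
    · simp [Set.indicator_of_notMem hx]
  calc ∫ x, noiseTerm γ u x ^ 2 ∂(gaussianReal 0 1)
      ≤ ∫ x, {x : ℝ | u < x ^ 2}.indicator (fun x => |x| ^ (2 * γ) + a ^ 2) x
          ∂(gaussianReal 0 1) :=
        integral_mono (memLp_noiseTerm hγ.le u).integrable_sq
          ((hi.add (integrable_const _)).indicator (measurableSet_lt_sq u)) hsq
    _ = (∫ x in {x : ℝ | u < x ^ 2}, |x| ^ (2 * γ) ∂(gaussianReal 0 1)) + P * a ^ 2 := by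
        rw [integral_indicator (measurableSet_lt_sq u),
          integral_add hi.integrableOn (integrable_const _)]
        simp [P]
    _ ≤ K₂ * u ^ (2 * γ / 2) * P + P * (K₁ * u ^ (γ / 2)) ^ 2 := by
        gcongr
        · exact h₂ u hu
        · exact h₁ u hu
    _ = (K₂ + K₁ ^ 2) * u ^ γ * P := by
        rw [mul_pow, hpow, mul_div_cancel_left₀ γ two_ne_zero]; ring
    _ ≤ (K₂ + K₁ ^ 2) * u ^ γ * (2 * exp (-u / 2)) := by
        gcongr
        exact gaussianReal_real_lt_sq_le hu'.le
    _ = _ := by ring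

lemma pi_gaussianReal_eq_map {ι : Type*} [Fintype ι] (θ : ι → ℝ) (ε : ℝ) :
    (Measure.pi fun i => gaussianReal (θ i) (ε ^ 2).toNNReal) =
      (Measure.pi fun _ : ι => gaussianReal 0 1).map fun x i => θ i + ε * x i := by
  have h : ∀ i, (gaussianReal 0 1).map (fun x => θ i + ε * x) =
      gaussianReal (θ i) (ε ^ 2).toNNReal := fun i => by
    have := gaussianReal_map_const_add (μ := ε * 0) (v := .mk (ε ^ 2) (sq_nonneg _) * 1) (θ i)
    rw [← gaussianReal_map_const_mul, Measure.map_map (by fun_prop) (by fun_prop)] at this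
    refine this.trans ?_
    congr 1
    · ring
    · ext
      simp [Real.coe_toNNReal _ (sq_nonneg ε)]
  have : ∀ i, SigmaFinite ((gaussianReal 0 1).map (fun x => θ i + ε * x)) := fun i => by
    rw [h i]; infer_instance
  simp_rw [← h]
  exact (Measure.pi_map_pi (μ := fun _ => gaussianReal 0 1) (f := fun i x => θ i + ε * x)
    fun i => by fun_prop).symm

/-- Pointwise bound on the squared error, in a form whose expectation involves only second
moments. -/
lemma threshold_norm_sub_norm_sq_le {ι : Type*} [Fintype ι] [DecidableEq ι]
    {γ u ε K s : ℝ} (hγ : 1 ≤ γ) (hu : 0 < u) (hε : 0 < ε) (hs : 0 < s)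
    (hK : truncatedMoment γ u ≤ K * u ^ (γ / 2)) (S : Finset ι) (hS : S.card ≤ s)
    (θ x : ι → ℝ) (hθ : ∀ i ∉ S, θ i = 0) :
    (|∑ i, (|θ i + ε * x i| ^ γ - ε ^ γ * truncatedMoment γ u) *
        (if ε ^ 2 * u < (θ i + ε * x i) ^ 2 then (1 : ℝ) else 0)| ^ (1 / γ)
      - (∑ i, |θ i| ^ γ) ^ (1 / γ)) ^ 2 ≤
    2 * ε ^ 2 * s ^ (2 / γ) * (u * (1 + 2 * (1 + K) ^ 2 +
        2 * (∑ i ∈ Sᶜ, noiseTerm γ u (x i)) ^ 2 / (s ^ 2 * u ^ γ)) +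
      (1 + (∑ i ∈ S, |x i| ^ γ) ^ 2 / s ^ 2)) := by
  have hγ0 : 0 < γ := by linarith
  have hp0 : 0 ≤ 2 / γ := by positivity
  have hp2 : 2 / γ ≤ 2 := by rw [div_le_iff₀ hγ0]; linarith
  set a := truncatedMoment γ u
  have ha : 0 ≤ a := truncatedMoment_nonneg γ u
  set B := ∑ i ∈ Sᶜ, noiseTerm γ u (x i)
  set X := ∑ i ∈ S, |x i| ^ γ
  have hX : 0 ≤ X := Finset.sum_nonneg fun i _ => by positivity
  have hv : 0 < u ^ (γ / 2) := by positivity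
  have hv2 : (u ^ (γ / 2)) ^ 2 = u ^ γ := by
    rw [← rpow_two, ← rpow_mul hu.le]; congr 1; ring
  have hscale : ∀ z : ℝ, |ε * z| ^ γ = ε ^ γ * |z| ^ γ := fun z => by
    rw [abs_mul, abs_of_pos hε, mul_rpow hε.le (abs_nonneg z)]
  have hcompl : ∑ i ∈ Sᶜ, (|θ i + ε * x i| ^ γ - ε ^ γ * a) *
      (if ε ^ 2 * u < (θ i + ε * x i) ^ 2 then (1 : ℝ) else 0) = ε ^ γ * B := by
    rw [Finset.mul_sum]
    refine Finset.sum_congr rfl fun i hi => ?_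
    have hiff : ε ^ 2 * u < (ε * x i) ^ 2 ↔ u < x i ^ 2 := by
      rw [mul_pow, mul_lt_mul_iff_right₀ (by positivity)]
    rw [hθ i (Finset.mem_compl.1 hi), zero_add, hscale, noiseTerm]
    simp only [hiff]
    ring
  have hsupp : ∑ i ∈ S, |θ i + ε * x i - θ i| ^ γ = ε ^ γ * X := by
    simp only [add_sub_cancel_left, hscale, X, Finset.mul_sum]
  have hthr : (ε ^ 2 * u) ^ (γ / 2) = ε ^ γ * u ^ (γ / 2) := by
    rw [mul_rpow (by positivity) hu.le, ← rpow_two, ← rpow_mul hε.le]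
    congr 2; ring
  have hmain := abs_threshold_norm_sub_norm_le hγ (A := ε ^ γ * a) (T := ε ^ 2 * u)
    (by positivity) (by positivity) S θ (fun i => θ i + ε * x i) hθ
  rw [hcompl, hsupp, hthr, abs_mul, abs_of_pos (rpow_pos_of_pos hε γ), ← mul_add,
    mul_left_comm, ← mul_add] at hmain
  have hroot : ∀ z : ℝ, 0 ≤ z → ((ε ^ γ * z) ^ (1 / γ)) ^ 2 = ε ^ 2 * z ^ (2 / γ) := fun z hz => by
    rw [mul_rpow (by positivity) hz, ← rpow_mul hε.le, mul_one_div_cancel hγ0.ne', rpow_one,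
      mul_pow, ← rpow_two (z ^ (1 / γ)), ← rpow_mul hz]
    congr 2; ring
  set Z := S.card * (u ^ (γ / 2) + a) + |B|
  have hZ : 0 ≤ Z := by positivity
  have hsv : (s * u ^ (γ / 2)) ^ (2 / γ) = s ^ (2 / γ) * u := by
    rw [mul_rpow hs.le hv.le, ← rpow_mul hu.le, div_mul_div_cancel₀' hγ0.ne', div_self two_ne_zero,
      rpow_one]
  have hZle : Z / (s * u ^ (γ / 2)) ≤ (1 + K) + |B| / (s * u ^ (γ / 2)) := by
    have : Z ≤ s * ((1 + K) * u ^ (γ / 2)) + |B| := by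
      have h1 : u ^ (γ / 2) + a ≤ (1 + K) * u ^ (γ / 2) := by linarith
      simp only [Z]
      gcongr
    rw [div_le_iff₀ (by positivity), add_mul, div_mul_cancel₀ _ (by positivity)]
    linarith
  have hZp : Z ^ (2 / γ) ≤ s ^ (2 / γ) * u * (1 + 2 * (1 + K) ^ 2 +
      2 * B ^ 2 / (s ^ 2 * u ^ γ)) := by
    refine (rpow_le_rpow_mul_one_add_sq hZ (c := s * u ^ (γ / 2)) (by positivity) hp0 hp2).trans ?_
    rw [hsv]
    refine mul_le_mul_of_nonneg_left ?_ (by positivity)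
    have h1 : (Z / (s * u ^ (γ / 2))) ^ 2 ≤ ((1 + K) + |B| / (s * u ^ (γ / 2))) ^ 2 := by gcongr
    have h2 := add_sq_le (a := 1 + K) (b := |B| / (s * u ^ (γ / 2)))
    rw [div_pow, mul_pow, hv2, sq_abs] at h2
    have h3 : 2 * B ^ 2 / (s ^ 2 * u ^ γ) = 2 * (B ^ 2 / (s ^ 2 * u ^ γ)) := by ring
    linarith
  have hXp : X ^ (2 / γ) ≤ s ^ (2 / γ) * (1 + X ^ 2 / s ^ 2) := by
    simpa only [div_pow] using rpow_le_rpow_mul_one_add_sq hX hs hp0 hp2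
  rw [← sq_abs]
  calc _ ≤ ((ε ^ γ * Z) ^ (1 / γ) + (ε ^ γ * X) ^ (1 / γ)) ^ 2 := by gcongr
    _ ≤ 2 * (((ε ^ γ * Z) ^ (1 / γ)) ^ 2 + ((ε ^ γ * X) ^ (1 / γ)) ^ 2) := add_sq_le
    _ = 2 * ε ^ 2 * (Z ^ (2 / γ) + X ^ (2 / γ)) := by rw [hroot Z hZ, hroot X hX]; ring
    _ ≤ 2 * ε ^ 2 * (s ^ (2 / γ) * u * (1 + 2 * (1 + K) ^ 2 + 2 * B ^ 2 / (s ^ 2 * u ^ γ)) +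
        s ^ (2 / γ) * (1 + X ^ 2 / s ^ 2)) := by gcongr
    _ = _ := by ring

/-- Theorem 5 (sparse zone upper bound for estimating the `ℓ_γ`-norm, `γ > 1`).
For every `γ > 1` there is a constant `C > 0` depending only on `γ` such that for all
integers `1 ≤ s ≤ d` with `s² ≤ 4d` and every `ε > 0`, the estimator
`n̂*_γ = |N̂*_γ|^{1/γ}` built from the thresholding estimator
`N̂*_γ = ∑_i (|y_i|^γ − ε^γ α_γ) 1_{y_i² > 2ε² log(1+d/s²)}` satisfies
`E_θ[(n̂*_γ − ‖θ‖_γ)²] ≤ C ε² s^{2/γ} log(1+d/s²)` for every `s`-sparse `θ`. -/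
theorem sparse_zone_upper_bound_norm (γ : ℝ) (hγ : 1 < γ) :
    ∃ C : ℝ, 0 < C ∧
      ∀ d s : ℕ, 1 ≤ s → s ≤ d → s ^ 2 ≤ 4 * d →
        ∀ ε : ℝ, 0 < ε →
          let α : ℝ :=
            (∫ x in {x : ℝ | 2 * Real.log (1 + (d : ℝ) / (s : ℝ) ^ 2) < x ^ 2}, |x| ^ γ
                ∂(gaussianReal 0 1)) /
              ((gaussianReal 0 1)
                {x : ℝ | 2 * Real.log (1 + (d : ℝ) / (s : ℝ) ^ 2) < x ^ 2}).toReal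
          ∀ θ : Fin d → ℝ, (Finset.univ.filter fun i => θ i ≠ 0).card ≤ s →
            ∫ y, (|∑ i, (|y i| ^ γ - ε ^ γ * α) *
                    (if 2 * ε ^ 2 * Real.log (1 + (d : ℝ) / (s : ℝ) ^ 2) < (y i) ^ 2
                      then (1 : ℝ) else 0)| ^ (1 / γ)
                  - (∑ i, |θ i| ^ γ) ^ (1 / γ)) ^ 2
                ∂(Measure.pi fun i : Fin d => gaussianReal (θ i) (ε ^ 2).toNNReal)
              ≤ C * ε ^ 2 * (s : ℝ) ^ (2 / γ) * Real.log (1 + (d : ℝ) / (s : ℝ) ^ 2) := by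
  have hγ0 : 0 < γ := by linarith
  have hu₀ : 0 < 2 * Real.log (5 / 4) := mul_pos two_pos (Real.log_pos (by norm_num))
  set u₀ : ℝ := 2 * Real.log (5 / 4)
  obtain ⟨K₁, hK₁, h₁⟩ := exists_truncatedMoment_le hγ0 hu₀
  obtain ⟨K₂, hK₂, h₂⟩ := exists_integral_noiseTerm_sq_le hγ0 hu₀
  set m : ℝ := ∫ x, (|x| ^ γ) ^ 2 ∂(gaussianReal 0 1)
  have hm : 0 ≤ m := integral_nonneg fun x => by positivity
  refine ⟨4 * (1 + 2 * (1 + K₁) ^ 2 + 2 * K₂ + (1 + m) / u₀), by positivity, ?_⟩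
  intro d s hs hsd hsq ε hε α θ hθ
  have hs0 : (0 : ℝ) < s := by exact_mod_cast hs
  set L : ℝ := Real.log (1 + (d : ℝ) / (s : ℝ) ^ 2) with hL
  have hratio : 1 / 4 ≤ (d : ℝ) / (s : ℝ) ^ 2 := by
    rw [div_le_div_iff₀ (by norm_num) (by positivity)]
    have : (s : ℝ) ^ 2 ≤ 4 * d := by exact_mod_cast hsq
    linarith
  set u : ℝ := 2 * L with hu_def
  have hu : u₀ ≤ u := by
    have := Real.log_le_log (by norm_num) (show (5 : ℝ) / 4 ≤ 1 + d / s ^ 2 by linarith)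
    simp only [u₀, hu_def, hL]
    linarith
  have hu0 : 0 < u := hu₀.trans_le hu
  have hα : α = truncatedMoment γ u := rfl
  set S : Finset (Fin d) := Finset.univ.filter fun i => θ i ≠ 0
  have hSs : (S.card : ℝ) ≤ s := by exact_mod_cast hθ
  have hθS : ∀ i ∉ S, θ i = 0 := fun i hi => by simpa [S] using hi
  have hexp : d * exp (-u / 2) ≤ (s : ℝ) ^ 2 := by
    have : -u / 2 = -L := by simp only [hu_def]; ring
    rw [this, exp_neg, hL, exp_log (by linarith), ← div_eq_mul_inv, div_le_iff₀ (by linarith),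
      mul_add, mul_div_cancel₀ _ (by positivity)]
    nlinarith
  have hB := integral_sq_sum_comp_eval_of_integral_eq_zero (memLp_noiseTerm hγ0.le u)
    (integral_noiseTerm hγ0.le hu0.le) Sᶜ
  have hX := integral_sq_sum_comp_eval_le (memLp_two_abs_rpow_gaussianReal hγ0.le) S
  have iB := (memLp_two_sum_comp_eval (memLp_noiseTerm hγ0.le u) Sᶜ).integrable_sq
  have iX := (memLp_two_sum_comp_eval (memLp_two_abs_rpow_gaussianReal hγ0.le) S).integrable_sq
  have hBle : ∫ x : Fin d → ℝ, (∑ i ∈ Sᶜ, noiseTerm γ u (x i)) ^ 2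
      ∂(Measure.pi fun _ => gaussianReal 0 1) ≤ K₂ * (s ^ 2 * u ^ γ) := by
    have hcard : ((Sᶜ).card : ℝ) ≤ d := by
      exact_mod_cast (Finset.card_le_univ _).trans_eq (Fintype.card_fin d)
    calc _ = _ := hB
      _ ≤ d * (K₂ * u ^ γ * exp (-u / 2)) := by
          gcongr
          exact h₂ u hu
      _ = K₂ * (d * exp (-u / 2) * u ^ γ) := by ring
      _ ≤ _ := by gcongr
  have hXle : ∫ x : Fin d → ℝ, (∑ i ∈ S, |x i| ^ γ) ^ 2
      ∂(Measure.pi fun _ => gaussianReal 0 1) ≤ s ^ 2 * m := hX.trans (by gcongr)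
  have iB' : Integrable (fun x : Fin d → ℝ => u * (1 + 2 * (1 + K₁) ^ 2 +
      2 * (∑ i ∈ Sᶜ, noiseTerm γ u (x i)) ^ 2 / (s ^ 2 * u ^ γ)))
      (Measure.pi fun _ => gaussianReal 0 1) :=
    ((integrable_const _).add ((iB.const_mul 2).div_const _)).const_mul u
  have iX' : Integrable (fun x : Fin d → ℝ => 1 + (∑ i ∈ S, |x i| ^ γ) ^ 2 / (s : ℝ) ^ 2)
      (Measure.pi fun _ => gaussianReal 0 1) :=
    (integrable_const _).add (iX.div_const _)
  have hite : ∀ i : Fin d, Measurable fun y : Fin d → ℝ =>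
      if 2 * ε ^ 2 * L < y i ^ 2 then (1 : ℝ) else 0 := fun i =>
    Measurable.ite (measurableSet_lt measurable_const (by fun_prop)) measurable_const
      measurable_const
  rw [pi_gaussianReal_eq_map, integral_map
    (measurable_pi_lambda _ fun i => by fun_prop).aemeasurable
    (Measurable.aestronglyMeasurable (by fun_prop))]
  have hthr : ∀ z : ℝ, 2 * ε ^ 2 * L < z ↔ ε ^ 2 * u < z := fun z => by
    rw [hu_def, ← mul_assoc, mul_comm (ε ^ 2)]
  simp only [hthr, hα]
  refine (integral_mono_of_nonneg (Filter.Eventually.of_forall fun x => sq_nonneg _)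
    ((iB'.add iX').const_mul (2 * ε ^ 2 * (s : ℝ) ^ (2 / γ)))
    (Filter.Eventually.of_forall fun x => threshold_norm_sub_norm_sq_le hγ.le hu0 hε hs0
      (h₁ u hu) S hSs θ x hθS)).trans ?_
  rw [integral_const_mul, integral_add' iB' iX', integral_const_mul,
    integral_add (integrable_const _) ((iB.const_mul 2).div_const _),
    integral_add (integrable_const _) (iX.div_const _), integral_div, integral_div,
    integral_const_mul, integral_const, integral_const, probReal_univ, one_smul, one_smul]
  calc _ ≤ 2 * ε ^ 2 * (s : ℝ) ^ (2 / γ) * (u * (1 + 2 * (1 + K₁) ^ 2 +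
        2 * (K₂ * (s ^ 2 * u ^ γ)) / (s ^ 2 * u ^ γ)) + (1 + s ^ 2 * m / s ^ 2)) := by gcongr
    _ = 2 * ε ^ 2 * (s : ℝ) ^ (2 / γ) * (u * (1 + 2 * (1 + K₁) ^ 2 + 2 * K₂) + (1 + m)) := by
        have : u ^ γ ≠ 0 := by positivity
        field_simp
    _ ≤ 2 * ε ^ 2 * (s : ℝ) ^ (2 / γ) * (u * (1 + 2 * (1 + K₁) ^ 2 + 2 * K₂) +
        (1 + m) * (u / u₀)) := by
        gcongr
        exact le_mul_of_one_le_right (by positivity) ((one_le_div hu₀).2 hu)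
    _ = _ := by simp only [hu_def]; ring
end

section
/- Let γ be an even positive integer, let ε > 0, let d, s be integers with 1 ≤ s ≤ d and s² ≥ d, and let ℓ be any loss function in the class L. Then there exist positive constants c₁ and c₂ depending only on γ and ℓ such that the infimum over all Borel measurable estimators T̂ : ℝ^d → ℝ of the supremum over θ ∈ B_0(s) of E_θ[ ℓ( c₁ (ε d^{1/(2γ)})^{−1} |T̂(y) − ‖θ‖_γ| ) ] is at least c₂. -/
open MeasureTheory ProbabilityTheory Real

open scoped ENNReal NNReal

lemma ENNReal.le_mul_sq_add {a t : ℝ≥0∞} (ha : a ≠ 0) (hat : 4 * (a * t) = 1) (x : ℝ≥0∞) :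
    x ≤ a * x ^ 2 + t := by
  rcases eq_or_ne x ⊤ with rfl | hx
  · simp [ha]
  rcases eq_or_ne a ⊤ with rfl | ha'
  · rcases eq_or_ne x 0 with rfl | hx0
    · simp
    · simp [hx0]
  rcases eq_or_ne t ⊤ with rfl | ht
  · simp
  lift x to ℝ≥0 using hx
  lift a to ℝ≥0 using ha'
  lift t to ℝ≥0 using ht
  norm_cast at *
  rw [← NNReal.coe_le_coe]
  have hat' : 4 * ((a : ℝ) * t) = 1 := by exact_mod_cast congrArg NNReal.toReal hat
  have hpos : (0 : ℝ) < a := by positivity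
  push_cast
  have h : 0 ≤ a * ((a : ℝ) * x ^ 2 + t - x) := by
    nlinarith [sq_nonneg ((a : ℝ) * x - 1 / 2)]
  linarith [(mul_nonneg_iff_of_pos_left hpos).1 h]

lemma MeasureTheory.Measure.pi_withDensity {ι : Type*} [Fintype ι] {α : ι → Type*}
    [∀ i, MeasurableSpace (α i)] (μ : ∀ i, Measure (α i)) [∀ i, IsProbabilityMeasure (μ i)]
    {f : ∀ i, α i → ℝ≥0∞} (hf : ∀ i, Measurable (f i))
    [∀ i, SigmaFinite ((μ i).withDensity (f i))] :
    Measure.pi (fun i => (μ i).withDensity (f i)) =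
      (Measure.pi μ).withDensity (fun x => ∏ i, f i (x i)) := by
  refine Measure.pi_eq fun s hs => ?_
  have hbox : MeasurableSet (Set.univ.pi s) := MeasurableSet.univ_pi hs
  have hind (x : ∀ i, α i) : (Set.univ.pi s).indicator (fun x => ∏ i, f i (x i)) x =
      ∏ i, (s i).indicator (f i) (x i) := by
    by_cases hx : x ∈ Set.univ.pi s
    · rw [Set.indicator_of_mem hx]
      exact Finset.prod_congr rfl fun i _ => (Set.indicator_of_mem (hx i trivial) _).symm
    · rw [Set.indicator_of_notMem hx]
      obtain ⟨i, hi⟩ : ∃ i, x i ∉ s i := by simpa [Set.mem_pi] using hx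
      exact (Finset.prod_eq_zero (Finset.mem_univ i) (Set.indicator_of_notMem hi _)).symm
  have hmeas (i : ι) : Measurable ((s i).indicator (f i)) := (hf i).indicator (hs i)
  rw [withDensity_apply _ hbox, ← lintegral_indicator hbox, lintegral_congr hind,
    lintegral_prod_eq_prod_lintegral_of_indepFun Finset.univ
      (fun i (x : ∀ i, α i) => (s i).indicator (f i) (x i))
      (iIndepFun_pi fun i => (hmeas i).aemeasurable)
      (fun i => (hmeas i).comp (measurable_pi_apply i))]
  refine Finset.prod_congr rfl fun i _ => ?_
  rw [withDensity_apply _ (hs i), ← lintegral_indicator (hs i),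
    (measurePreserving_eval μ i).lintegral_comp (hmeas i)]

lemma gaussianReal_eq_withDensity_gaussianReal_zero (m : ℝ) {v : ℝ≥0} (hv : v ≠ 0) :
    gaussianReal m v = (gaussianReal 0 v).withDensity
      (fun x => ENNReal.ofReal (exp (m * x / v - m ^ 2 / (2 * v)))) := by
  have hv' : (v : ℝ) ≠ 0 := by exact_mod_cast hv
  rw [gaussianReal_of_var_ne_zero _ hv, gaussianReal_of_var_ne_zero _ hv,
    ← withDensity_mul _ (measurable_gaussianPDF _ _) (by fun_prop)]
  congr 1
  ext x
  rw [Pi.mul_apply, gaussianPDF, gaussianPDF, ← ENNReal.ofReal_mul (gaussianPDFReal_nonneg _ _ _),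
    gaussianPDFReal, gaussianPDFReal, mul_assoc (√(2 * π * v))⁻¹, ← exp_add]
  congr 3
  field_simp
  ring

/-- The likelihood ratio of `N(θ, v I)` with respect to `N(0, v I)`. -/
noncomputable def gaussianLikelihood {ι : Type*} [Fintype ι] (v : ℝ≥0) (θ y : ι → ℝ) : ℝ≥0∞ :=
  ∏ i, ENNReal.ofReal (exp (θ i * y i / v - θ i ^ 2 / (2 * v)))

lemma measurable_gaussianLikelihood {ι : Type*} [Fintype ι] (v : ℝ≥0) (θ : ι → ℝ) :
    Measurable (gaussianLikelihood v θ) := by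
  unfold gaussianLikelihood
  fun_prop

lemma pi_gaussianReal_eq_withDensity {ι : Type*} [Fintype ι] {v : ℝ≥0} (hv : v ≠ 0) (θ : ι → ℝ) :
    Measure.pi (fun i => gaussianReal (θ i) v) =
      (Measure.pi fun _ : ι => gaussianReal 0 v).withDensity (gaussianLikelihood v θ) := by
  have h := fun i => gaussianReal_eq_withDensity_gaussianReal_zero (θ i) hv
  have (i : ι) : SigmaFinite ((gaussianReal 0 v).withDensity
      (fun x => ENNReal.ofReal (exp (θ i * x / v - θ i ^ 2 / (2 * v))))) := by
    rw [← h i]; infer_instance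
  simp_rw [h]
  exact Measure.pi_withDensity (fun _ : ι => gaussianReal 0 v) (fun i => by fun_prop)

lemma lintegral_gaussianLikelihood {ι : Type*} [Fintype ι] {v : ℝ≥0} (hv : v ≠ 0) (θ : ι → ℝ) :
    ∫⁻ y, gaussianLikelihood v θ y ∂(Measure.pi fun _ : ι => gaussianReal 0 v) = 1 := by
  rw [← setLIntegral_univ, ← withDensity_apply _ MeasurableSet.univ,
    ← pi_gaussianReal_eq_withDensity hv, measure_univ]

lemma gaussianLikelihood_mul {ι : Type*} [Fintype ι] {v : ℝ≥0} (hv : v ≠ 0) (θ η y : ι → ℝ) :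
    gaussianLikelihood v θ y * gaussianLikelihood v η y =
      ENNReal.ofReal (exp (∑ i, θ i * η i / v)) * gaussianLikelihood v (θ + η) y := by
  have hv' : (v : ℝ) ≠ 0 := by exact_mod_cast hv
  unfold gaussianLikelihood
  rw [exp_sum, ENNReal.ofReal_prod_of_nonneg fun _ _ => (exp_pos _).le, ← Finset.prod_mul_distrib,
    ← Finset.prod_mul_distrib]
  refine Finset.prod_congr rfl fun i _ => ?_
  rw [← ENNReal.ofReal_mul (exp_pos _).le, ← ENNReal.ofReal_mul (exp_pos _).le, ← exp_add,
    ← exp_add, Pi.add_apply]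
  congr 2
  field_simp
  ring

lemma lintegral_gaussianLikelihood_mul {ι : Type*} [Fintype ι] {v : ℝ≥0} (hv : v ≠ 0)
    (θ η : ι → ℝ) :
    ∫⁻ y, gaussianLikelihood v θ y * gaussianLikelihood v η y
      ∂(Measure.pi fun _ : ι => gaussianReal 0 v) = ENNReal.ofReal (exp (∑ i, θ i * η i / v)) := by
  simp_rw [gaussianLikelihood_mul hv]
  rw [lintegral_const_mul _ (measurable_gaussianLikelihood v _), lintegral_gaussianLikelihood hv,
    mul_one]

/-- Testing a simple hypothesis against a uniform mixture with bounded second moment of the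
likelihood ratio. -/
lemma test_simple_against_mixture {Ω κ : Type*} [MeasurableSpace Ω] [Fintype κ] [Nonempty κ]
    (P : Measure Ω) [IsProbabilityMeasure P] {g : κ → Ω → ℝ≥0∞} (hg : ∀ i, Measurable (g i))
    (hg1 : ∀ i, ∫⁻ y, g i y ∂P = 1) {C : ℝ} (hC : 0 < C)
    (hg2 : ∑ i, ∑ j, ∫⁻ y, g i y * g j y ∂P ≤ ENNReal.ofReal ((Fintype.card κ : ℝ) ^ 2 * C))
    {A : Set Ω} (hA : MeasurableSet A) :
    ENNReal.ofReal (1 / (4 * C)) ≤ P A ∨ ∃ i, 1 / 2 ≤ P.withDensity (g i) Aᶜ := by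
  by_contra! h
  obtain ⟨hPA, hQ⟩ := h
  set N : ℝ := (Fintype.card κ : ℝ) with hN
  have hNpos : 0 < N := by simp [hN, Fintype.card_pos]
  have hprob (i : κ) : IsProbabilityMeasure (P.withDensity (g i)) :=
    ⟨by rw [withDensity_apply _ MeasurableSet.univ, setLIntegral_univ, hg1]⟩
  have hlow : ENNReal.ofReal (N / 2) < ∑ i, P.withDensity (g i) A := by
    have hi (i : κ) : ENNReal.ofReal (1 / 2) < P.withDensity (g i) A := by
      have hadd := prob_add_prob_compl (μ := P.withDensity (g i)) hA
      by_contra! hle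
      have := ENNReal.add_lt_add_of_le_of_lt (by simp) hle (hQ i)
      rw [hadd, ENNReal.ofReal_div_of_pos two_pos] at this
      simp [ENNReal.inv_two_add_inv_two] at this
    calc ENNReal.ofReal (N / 2) = ∑ _i : κ, ENNReal.ofReal (1 / 2) := by
          rw [Finset.sum_const, nsmul_eq_mul, Finset.card_univ,
            ← ENNReal.ofReal_natCast, ← ENNReal.ofReal_mul (by positivity), ← hN]
          congr 1; ring
      _ < _ := ENNReal.sum_lt_sum_of_nonempty Finset.univ_nonempty fun i _ => hi i
  have hup : ∑ i, P.withDensity (g i) A ≤ ENNReal.ofReal (N / 2) := by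
    have hpt (y : Ω) := ENNReal.le_mul_sq_add (a := ENNReal.ofReal (1 / (4 * C * N)))
      (t := ENNReal.ofReal (C * N)) (by simp; positivity)
      (by
        rw [← ENNReal.ofReal_mul (by positivity), show (4 : ℝ≥0∞) = ENNReal.ofReal 4 by simp,
          ← ENNReal.ofReal_mul (by positivity), ← ENNReal.ofReal_one]
        congr 1; field_simp) (∑ i, g i y)
    have hS : Measurable fun y => (∑ i, g i y) ^ 2 := by fun_prop
    calc ∑ i, P.withDensity (g i) A = ∫⁻ y in A, ∑ i, g i y ∂P := by
          rw [lintegral_finsetSum _ fun i _ => hg i]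
          exact Finset.sum_congr rfl fun i _ => withDensity_apply _ hA
      _ ≤ ∫⁻ y in A, (ENNReal.ofReal (1 / (4 * C * N)) * (∑ i, g i y) ^ 2
            + ENNReal.ofReal (C * N)) ∂P := lintegral_mono hpt
      _ = ENNReal.ofReal (1 / (4 * C * N)) * ∫⁻ y in A, (∑ i, g i y) ^ 2 ∂P
            + ENNReal.ofReal (C * N) * P A := by
          rw [lintegral_add_right _ measurable_const, lintegral_const_mul _ hS, setLIntegral_const]
      _ ≤ ENNReal.ofReal (1 / (4 * C * N)) * ENNReal.ofReal (N ^ 2 * C)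
            + ENNReal.ofReal (C * N) * ENNReal.ofReal (1 / (4 * C)) := by
          gcongr
          refine (setLIntegral_le_lintegral _ _).trans (le_of_eq_of_le ?_ hg2)
          simp_rw [sq, Finset.sum_mul_sum]
          rw [lintegral_finsetSum _ fun i _ => by fun_prop]
          exact Finset.sum_congr rfl fun i _ => lintegral_finsetSum _ fun j _ => by fun_prop
      _ = ENNReal.ofReal (N / 2) := by
          rw [← ENNReal.ofReal_mul (by positivity), ← ENNReal.ofReal_mul (by positivity),
            ← ENNReal.ofReal_add (by positivity) (by positivity)]
          congr 1; field_simp; norm_num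
  exact absurd hlow hup.not_gt

lemma sum_sum_exp_card_eq_le (k : ℕ) (hk : 0 < k) :
    ∑ f : Fin k → Fin k, ∑ f' : Fin k → Fin k, exp (∑ j, if f j = f' j then 1 else 0) ≤
      (Fintype.card (Fin k → Fin k) : ℝ) ^ 2 * exp (exp 1 - 1) := by
  have hk' : (0 : ℝ) < k := by exact_mod_cast hk
  have hinner (f : Fin k → Fin k) :
      ∑ f' : Fin k → Fin k, exp (∑ j, if f j = f' j then 1 else 0) = (k + (exp 1 - 1)) ^ k := by
    simp_rw [exp_sum]
    rw [← Fintype.prod_sum fun j b => exp (if f j = b then 1 else 0)]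
    have hb (j : Fin k) : ∑ b, exp (if f j = b then 1 else 0) = k + (exp 1 - 1) := by
      have (b : Fin k) : exp (if f j = b then 1 else 0) =
          1 + if f j = b then exp 1 - 1 else 0 := by split_ifs <;> simp
      simp [this, Finset.sum_add_distrib]
    simp [hb]
  have hle : ((k : ℝ) + (exp 1 - 1)) ^ k ≤ k ^ k * exp (exp 1 - 1) := by
    have h1 : (k : ℝ) + (exp 1 - 1) ≤ k * exp ((exp 1 - 1) / k) := by
      have := add_one_le_exp ((exp 1 - 1) / k)
      calc (k : ℝ) + (exp 1 - 1) = k * ((exp 1 - 1) / k + 1) := by field_simp; ring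
        _ ≤ _ := by gcongr
    calc ((k : ℝ) + (exp 1 - 1)) ^ k ≤ (k * exp ((exp 1 - 1) / k)) ^ k := by
          gcongr
          linarith [add_one_le_exp (1 : ℝ)]
      _ = _ := by rw [mul_pow, ← exp_nat_mul]; congr 2; field_simp
  simp_rw [hinner]
  rw [Finset.sum_const, nsmul_eq_mul, Finset.card_univ]
  simp only [Fintype.card_fun, Fintype.card_fin, Nat.cast_pow]
  calc ((k : ℝ) ^ k) * (k + (exp 1 - 1)) ^ k ≤ k ^ k * (k ^ k * exp (exp 1 - 1)) := by gcongr
    _ = _ := by ring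

/-- The vector with entries `ε` at the positions `e (j, f j)` and zeros elsewhere. -/
noncomputable def spikeVector {k d : ℕ} (e : Fin k × Fin k ↪ Fin d) (ε : ℝ) (f : Fin k → Fin k) :
    Fin d → ℝ :=
  fun i => if i ∈ Finset.univ.image (fun j => e (j, f j)) then ε else 0

lemma card_support_spikeVector_le {k d : ℕ} (e : Fin k × Fin k ↪ Fin d) (ε : ℝ)
    (f : Fin k → Fin k) : (Finset.univ.filter fun i => spikeVector e ε f i ≠ 0).card ≤ k := by
  calc _ ≤ (Finset.univ.image fun j => e (j, f j)).card := by
        refine Finset.card_le_card fun i hi => ?_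
        by_contra hni
        exact (Finset.mem_filter.1 hi).2 (if_neg hni)
    _ ≤ k := Finset.card_image_le.trans (by simp)

lemma sum_spikeVector {k d : ℕ} (e : Fin k × Fin k ↪ Fin d) (ε : ℝ) (f : Fin k → Fin k)
    (F : Fin d → ℝ → ℝ) (hF : ∀ i, F i 0 = 0) :
    ∑ i, F i (spikeVector e ε f i) = ∑ j, F (e (j, f j)) ε := by
  have (i : Fin d) : F i (spikeVector e ε f i) =
      if i ∈ Finset.univ.image (fun j => e (j, f j)) then F i ε else 0 := by
    unfold spikeVector
    split_ifs <;> simp [hF]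
  simp_rw [this]
  rw [Finset.sum_ite_mem, Finset.univ_inter, Finset.sum_image]
  intro j _ j' _ h
  exact (Prod.ext_iff.1 (e.injective h)).1

lemma norm_spikeVector {k d γ : ℕ} (hγ : 0 < γ) (e : Fin k × Fin k ↪ Fin d) {ε : ℝ} (hε : 0 < ε)
    (f : Fin k → Fin k) :
    (∑ i, |spikeVector e ε f i| ^ γ) ^ ((1 : ℝ) / γ) = ε * (k : ℝ) ^ ((1 : ℝ) / γ) := by
  rw [sum_spikeVector e ε f (fun _ x => |x| ^ γ) (by simp [hγ.ne']), Finset.sum_const,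
    Finset.card_univ, Fintype.card_fin, nsmul_eq_mul, abs_of_pos hε,
    mul_rpow (by positivity) (by positivity), one_div, pow_rpow_inv_natCast hε.le hγ.ne', mul_comm]

lemma sum_spikeVector_mul {k d : ℕ} (e : Fin k × Fin k ↪ Fin d) {ε : ℝ} (hε : 0 < ε)
    (f f' : Fin k → Fin k) :
    ∑ i, spikeVector e ε f i * spikeVector e ε f' i / ((ε ^ 2).toNNReal : ℝ) =
      ∑ j, if f j = f' j then 1 else 0 := by
  rw [sum_spikeVector e ε f
    (fun i x => x * spikeVector e ε f' i / ((ε ^ 2).toNNReal : ℝ)) (by simp)]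
  refine Finset.sum_congr rfl fun j _ => ?_
  have hmem : e (j, f j) ∈ Finset.univ.image (fun j => e (j, f' j)) ↔ f j = f' j := by
    simp [eq_comm]
  rw [coe_toNNReal _ (sq_nonneg ε), spikeVector]
  simp only [hmem]
  split_ifs
  · field_simp
  · simp

lemma rate_le_norm {d γ : ℕ} (hγ : 0 < γ) :
    (d : ℝ) ^ ((1 : ℝ) / (2 * γ)) ≤ 2 * (d.sqrt : ℝ) ^ ((1 : ℝ) / γ) := by
  rcases Nat.eq_zero_or_pos d with rfl | hd
  · simp [hγ.ne']
  have hγ' : (1 : ℝ) ≤ γ := by exact_mod_cast hγ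
  have hd4 : (d : ℝ) ≤ (2 * d.sqrt : ℝ) ^ 2 := by
    have h1 : d < (d.sqrt + 1) ^ 2 := Nat.lt_succ_sqrt' d
    have h2 : 1 ≤ d.sqrt := Nat.sqrt_pos.2 hd
    have : d ≤ (2 * d.sqrt) ^ 2 := h1.le.trans (Nat.pow_le_pow_left (by omega) 2)
    exact_mod_cast this
  calc (d : ℝ) ^ ((1 : ℝ) / (2 * γ)) ≤ ((2 * d.sqrt : ℝ) ^ 2) ^ ((1 : ℝ) / (2 * γ)) := by gcongr
    _ = (2 * d.sqrt : ℝ) ^ ((1 : ℝ) / γ) := by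
        rw [← rpow_natCast, ← rpow_mul (by positivity)]
        congr 1
        push_cast
        field_simp
    _ = 2 ^ ((1 : ℝ) / γ) * (d.sqrt : ℝ) ^ ((1 : ℝ) / γ) := mul_rpow (by norm_num) (by positivity)
    _ ≤ 2 * (d.sqrt : ℝ) ^ ((1 : ℝ) / γ) := by
        gcongr
        exact rpow_le_self_of_one_le (by norm_num) (by rw [div_le_one (by positivity)]; exact hγ')

/-- Theorem 9 (dense zone lower bound for estimating the `ℓ_γ`-norm, `γ` even).
For an even positive integer `γ` and every loss `ℓ` in the class `L`, there exist
constants `c₁, c₂ > 0` depending only on `γ` and `ℓ` such that for all integers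
`1 ≤ s ≤ d` with `s² ≥ d` and every `ε > 0`, every Borel measurable estimator
`T̂` satisfies
`sup_{θ ∈ B_0(s)} E_θ[ℓ(c₁ (ε d^{1/(2γ)})^{-1} |T̂(y) − ‖θ‖_γ|)] ≥ c₂`. -/
theorem lower_bound_norm_even_dense (γ : ℕ) (hγeven : Even γ) (hγpos : 0 < γ) (ℓ : ℝ → ℝ)
    (hmono : ∀ x y : ℝ, 0 ≤ x → x ≤ y → ℓ x ≤ ℓ y) (hzero : ℓ 0 = 0)
    (hnonneg : ∀ x : ℝ, 0 ≤ x → 0 ≤ ℓ x) (hne : ∃ x : ℝ, 0 ≤ x ∧ ℓ x ≠ 0) :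
    ∃ c₁ c₂ : ℝ, 0 < c₁ ∧ 0 < c₂ ∧
      ∀ d s : ℕ, 1 ≤ s → s ≤ d → d ≤ s ^ 2 → ∀ ε : ℝ, 0 < ε →
        ∀ T : (Fin d → ℝ) → ℝ, Measurable T →
          ENNReal.ofReal c₂ ≤
            ⨆ θ ∈ {θ : Fin d → ℝ | (Finset.univ.filter fun i => θ i ≠ 0).card ≤ s},
              ∫⁻ y, ENNReal.ofReal
                  (ℓ (c₁ * (ε * (d : ℝ) ^ ((1 : ℝ) / (2 * γ)))⁻¹ *
                    |T y - (∑ i, |θ i| ^ (γ : ℕ)) ^ ((1 : ℝ) / γ)|))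
                ∂(Measure.pi fun i : Fin d => gaussianReal (θ i) (ε ^ 2).toNNReal) := by
  obtain ⟨x₀, hx₀, hℓx₀⟩ := hne
  have hx₀pos : 0 < x₀ := hx₀.lt_of_ne fun h => hℓx₀ (h ▸ hzero)
  have hℓpos : 0 < ℓ x₀ := (hnonneg x₀ hx₀).lt_of_ne' hℓx₀
  set C : ℝ := exp (exp 1 - 1) with hC
  have hCpos : 0 < C := exp_pos _
  have hC1 : 1 ≤ C := one_le_exp (by linarith [add_one_le_exp (1 : ℝ)])
  refine ⟨4 * x₀, ℓ x₀ * (1 / (4 * C)), by positivity, by positivity, ?_⟩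
  intro d s hs hsd hds ε hε T hT
  set v : ℝ≥0 := (ε ^ 2).toNNReal with hv
  have hv0 : v ≠ 0 := by simp [hv, hε.ne']
  have hd : 0 < d := by omega
  set k := d.sqrt with hk
  have hkpos : 0 < k := Nat.sqrt_pos.2 hd
  have hks : k ≤ s := by
    rw [← Nat.sqrt_eq' s]
    exact Nat.sqrt_le_sqrt hds
  set ρ : ℝ := ε * (d : ℝ) ^ ((1 : ℝ) / (2 * γ)) with hρ
  have hρpos : 0 < ρ := by positivity
  set r : ℝ := ε * (k : ℝ) ^ ((1 : ℝ) / γ) with hr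
  have hρr : ρ ≤ 2 * r := by
    have := mul_le_mul_of_nonneg_left (rate_le_norm (d := d) hγpos) hε.le
    rw [hρ, hr]
    linarith
  have key (θ : Fin d → ℝ) (hθ : (Finset.univ.filter fun i => θ i ≠ 0).card ≤ s)
      (B : Set (Fin d → ℝ)) (hB : MeasurableSet B)
      (hBT : ∀ y ∈ B, r / 2 ≤ |T y - (∑ i, |θ i| ^ γ) ^ ((1 : ℝ) / γ)|)
      (hPB : ENNReal.ofReal (1 / (4 * C)) ≤ Measure.pi (fun i => gaussianReal (θ i) v) B) :
      ENNReal.ofReal (ℓ x₀ * (1 / (4 * C))) ≤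
        ⨆ θ ∈ {θ : Fin d → ℝ | (Finset.univ.filter fun i => θ i ≠ 0).card ≤ s},
          ∫⁻ y, ENNReal.ofReal (ℓ (4 * x₀ * ρ⁻¹ *
            |T y - (∑ i, |θ i| ^ γ) ^ ((1 : ℝ) / γ)|))
            ∂(Measure.pi fun i : Fin d => gaussianReal (θ i) v) := by
    refine le_trans ?_ (le_iSup₂_of_le θ hθ le_rfl)
    calc ENNReal.ofReal (ℓ x₀ * (1 / (4 * C)))
        ≤ ENNReal.ofReal (ℓ x₀) * Measure.pi (fun i => gaussianReal (θ i) v) B := by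
          rw [ENNReal.ofReal_mul hℓpos.le]
          gcongr
      _ = ∫⁻ y in B, ENNReal.ofReal (ℓ x₀) ∂(Measure.pi fun i => gaussianReal (θ i) v) :=
          (setLIntegral_const _ _).symm
      _ ≤ ∫⁻ y in B, ENNReal.ofReal (ℓ (4 * x₀ * ρ⁻¹ *
            |T y - (∑ i, |θ i| ^ γ) ^ ((1 : ℝ) / γ)|))
            ∂(Measure.pi fun i : Fin d => gaussianReal (θ i) v) := by
          refine setLIntegral_mono' hB fun y hy => ENNReal.ofReal_le_ofReal (hmono _ _ hx₀ ?_)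
          calc x₀ = 4 * x₀ * ρ⁻¹ * (ρ / 4) := by field_simp
            _ ≤ _ := by
              gcongr
              linarith [hBT y hy]
      _ ≤ _ := setLIntegral_le_lintegral _ _
  obtain ⟨e⟩ : Nonempty (Fin k × Fin k ↪ Fin d) :=
    Function.Embedding.nonempty_of_card_le (by simpa using Nat.sqrt_le d)
  have : Nonempty (Fin k) := ⟨⟨0, hkpos⟩⟩
  have hmom : ∑ f : Fin k → Fin k, ∑ f' : Fin k → Fin k,
      ∫⁻ y, gaussianLikelihood v (spikeVector e ε f) y * gaussianLikelihood v (spikeVector e ε f') y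
        ∂(Measure.pi fun _ : Fin d => gaussianReal 0 v) ≤
      ENNReal.ofReal ((Fintype.card (Fin k → Fin k) : ℝ) ^ 2 * C) := by
    simp_rw [lintegral_gaussianLikelihood_mul hv0, hv, sum_spikeVector_mul e hε]
    simp_rw [← ENNReal.ofReal_sum_of_nonneg fun _ _ => (exp_pos _).le]
    rw [← ENNReal.ofReal_sum_of_nonneg fun _ _ => Finset.sum_nonneg fun _ _ => (exp_pos _).le]
    exact ENNReal.ofReal_le_ofReal (sum_sum_exp_card_eq_le k hkpos)
  have hA : MeasurableSet {y | r / 2 ≤ T y} := measurableSet_le measurable_const hT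
  rcases test_simple_against_mixture (Measure.pi fun _ : Fin d => gaussianReal 0 v)
    (fun f : Fin k → Fin k => measurable_gaussianLikelihood v (spikeVector e ε f))
    (fun f => lintegral_gaussianLikelihood hv0 _) hCpos hmom hA with h | ⟨f, h⟩
  · refine key 0 (by simp) _ hA (fun y hy => ?_) h
    have h0 : (∑ i : Fin d, |(0 : Fin d → ℝ) i| ^ γ) ^ ((1 : ℝ) / γ) = 0 := by
      simp [hγpos.ne']
    rw [h0, sub_zero]
    exact le_trans hy (le_abs_self _)
  · refine key (spikeVector e ε f) ((card_support_spikeVector_le e ε f).trans hks) _ hA.compl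
      (fun y hy => ?_) ?_
    · rw [norm_spikeVector hγpos e hε, ← hr, abs_sub_comm]
      have : T y < r / 2 := not_le.1 hy
      exact le_trans (by linarith) (le_abs_self _)
    · rw [pi_gaussianReal_eq_withDensity hv0]
      refine le_trans ?_ h
      rw [show (1 / 2 : ℝ≥0∞) = ENNReal.ofReal (1 / 2) by
        rw [ENNReal.ofReal_div_of_pos two_pos]; simp]
      refine ENNReal.ofReal_le_ofReal ?_
      gcongr
      linarith
end
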